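/- Let s ∈ (1/2, 1] and let x ∈ (0,1) be irrational. If Σ_s(x) < ∞, then the sequence of partial sums F_{s,N}(x) converges as N → ∞. -/

import Mathlib

open MeasureTheory Filter Set
open scoped Real BigOperators ENNReal

/-- Partial sum `F_{s,N}(x) = ∑_{n=1}^N n^{-s} e^{2πi n² x}`. -/
noncomputable def FsN (s : ℝ) (N : ℕ) (x : ℝ) : ℂ :=
  ∑ n ∈ Finset.Icc 1 N,
    (((n : ℝ) ^ (-s) : ℝ) : ℂ) * Complex.exp (2 * Real.pi * Complex.I * (n : ℂ) ^ 2 * (x : ℂ))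

/-- Iterates of the Gauss map: `cfX x 0 = x`, `cfX x (j+1) = frac (1 / cfX x j)`. -/
noncomputable def cfX (x : ℝ) : ℕ → ℝ
  | 0 => x
  | j + 1 => Int.fract (cfX x j)⁻¹

/-- Partial quotients: `cfA x j = a_{j+1} = ⌊1 / x_j⌋`. -/
noncomputable def cfA (x : ℝ) (j : ℕ) : ℤ := ⌊(cfX x j)⁻¹⌋

/-- Numerators of the convergents of x ∈ (0,1): `p_0 = 0`, `p_1 = 1`,
`p_{j+2} = a_{j+2} p_{j+1} + p_j`. -/
noncomputable def cfP (x : ℝ) : ℕ → ℤ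
  | 0 => 0
  | 1 => 1
  | j + 2 => cfA x (j + 1) * cfP x (j + 1) + cfP x j

/-- Denominators of the convergents of x ∈ (0,1): `q_0 = 1`, `q_1 = a_1`,
`q_{j+2} = a_{j+2} q_{j+1} + q_j`. -/
noncomputable def cfQ (x : ℝ) : ℕ → ℤ
  | 0 => 1
  | 1 => cfA x 0
  | j + 2 => cfA x (j + 1) * cfQ x (j + 1) + cfQ x j

/-- `h_j = x - p_j/q_j`. -/
noncomputable def cfH (x : ℝ) (j : ℕ) : ℝ := x - (cfP x j : ℝ) / (cfQ x j : ℝ)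

/-- `r_j`, defined by `|h_j| = q_j^{-r_j}`, i.e. `r_j = -log_{q_j} |h_j|`. -/
noncomputable def cfR (x : ℝ) (j : ℕ) : ℝ := -Real.logb (cfQ x j : ℝ) |cfH x j|

/-- The filter of large indices `j ≥ 1` whose convergent denominator `q_j` is not
twice an odd number (i.e. `q_j ≢ 2 [MOD 4]`). -/
def oddFilter (x : ℝ) : Filter ℕ :=
  Filter.atTop ⊓ Filter.principal {j : ℕ | 1 ≤ j ∧ cfQ x j % 4 ≠ 2}

/-- The approximation rate `r_odd(x) ∈ [2,∞]`: the limsup of the `r_j` over indices `j`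
with `q_j ≢ 2 [MOD 4]`. -/
noncomputable def rOdd (x : ℝ) : ℝ≥0∞ :=
  Filter.limsup (fun j => ENNReal.ofReal (cfR x j)) (oddFilter x)

/-- `δ_j`: equal to `1` when `s < 1`, and to `log (q_{j+1}/q_j)` when `s = 1`. -/
noncomputable def deltaJ (s x : ℝ) (j : ℕ) : ℝ :=
  if s < 1 then 1 else Real.log ((cfQ x (j + 1) : ℝ) / (cfQ x j : ℝ))

/-- The summand `δ_j √(q_{j+1} / (q_j q_{j+1})^s)`. -/
noncomputable def sigTerm (s x : ℝ) (j : ℕ) : ℝ :=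
  deltaJ s x j *
    Real.sqrt ((cfQ x (j + 1) : ℝ) / ((cfQ x j : ℝ) * (cfQ x (j + 1) : ℝ)) ^ s)

/-- `Σ_s(x) = ∑_{j ≥ 1, q_j ≢ 2 (4)} δ_j √(q_{j+1}/(q_j q_{j+1})^s)`, valued in `[0,∞]`. -/
noncomputable def SigmaS (s x : ℝ) : ℝ≥0∞ :=
  ∑' j : ℕ, if 1 ≤ j ∧ cfQ x j % 4 ≠ 2 then ENNReal.ofReal (sigTerm s x j) else 0


theorem conv_of_blocks (a : ℕ → ℂ) (Nj : ℕ → ℕ) (B : ℕ → ℝ) (hmono : Monotone Nj)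
    (htop : Tendsto Nj atTop atTop) (hB : Summable B) (j0 : ℕ)
    (h : ∀ j, j0 ≤ j → ∀ K, Nj j ≤ K → K ≤ Nj (j+1) → ‖∑ n ∈ Finset.Ico (Nj j) K, a n‖ ≤ B j) :
    ∃ L : ℂ, Tendsto (fun N : ℕ => ∑ n ∈ Finset.range N, a n) atTop (nhds L) := by
  set u : ℕ → ℂ := fun N => ∑ n ∈ Finset.range N, a n with hu
  have hd : ∀ j, j0 ≤ j → ∀ K, Nj j ≤ K → K ≤ Nj (j+1) → ‖u K - u (Nj j)‖ ≤ B j := by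
    intro j hj K h1 h2
    have := h j hj K h1 h2
    rwa [Finset.sum_Ico_eq_sub _ h1] at this
  have hc : CauchySeq (fun j => u (Nj (j + j0))) := by
    apply cauchySeq_of_summable_dist
    refine Summable.of_nonneg_of_le (fun _ => dist_nonneg) (fun j => ?_)
      ((summable_nat_add_iff j0).2 hB)
    rw [dist_comm, dist_eq_norm]
    have := hd (j + j0) (by omega) (Nj (j + j0 + 1)) (hmono (by omega)) le_rfl
    rwa [show j.succ + j0 = j + j0 + 1 by omega]
  obtain ⟨L, hL⟩ := cauchySeq_tendsto_of_complete hc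
  refine ⟨L, ?_⟩
  rw [Metric.tendsto_atTop] at hL ⊢
  intro ε hε
  obtain ⟨J1, hJ1⟩ := hL (ε/2) (by linarith)
  have hB0 := hB.tendsto_atTop_zero
  obtain ⟨J2, hJ2⟩ := (Metric.tendsto_atTop.1 hB0) (ε/2) (by linarith)
  set J := J1 + J2 + j0 with hJ
  refine ⟨Nj J, fun K hK => ?_⟩
  obtain ⟨T, hT⟩ := (htop.eventually_gt_atTop K).exists
  have hex : ∃ j, K < Nj j := ⟨T, hT⟩
  classical
  have hs := Nat.find_spec hex
  have hmin := fun m hm => Nat.find_min hex (m := m) hm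
  set t := Nat.find hex with ht
  have htJ : J < t := by
    by_contra hcon
    have := hmono (not_lt.1 hcon)
    omega
  clear_value t
  clear ht
  obtain ⟨j, rfl⟩ : ∃ j, t = j + 1 := ⟨t - 1, by omega⟩
  have hjK : Nj j ≤ K := not_lt.1 (hmin j (by omega))
  have e1 := hd j (by omega) K hjK hs.le
  have e2 := hJ1 (j - j0) (by omega)
  have e3 := hJ2 j (by omega)
  rw [show j - j0 + j0 = j by omega] at e2
  rw [Real.dist_eq, sub_zero] at e3
  have e4 := le_abs_self (B j)
  calc dist (u K) L ≤ dist (u K) (u (Nj j)) + dist (u (Nj j)) L := dist_triangle _ _ _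
    _ < ε := by rw [dist_eq_norm]; linarith

theorem abel_bound (z : ℕ → ℂ) (w : ℕ → ℝ) (M : ℕ) (B : ℝ)
    (hw0 : ∀ n, M ≤ n → 0 ≤ w n) (hw : ∀ n, M ≤ n → w (n+1) ≤ w n) (N : ℕ) (hMN : M ≤ N)
    (hz : ∀ K, M ≤ K → K ≤ N → ‖∑ n ∈ Finset.Ico M K, z n‖ ≤ B) :
    ‖∑ n ∈ Finset.Ico M N, (w n : ℂ) * z n‖ ≤ w M * B := by
  have key : ∀ K, M ≤ K → ∑ n ∈ Finset.Ico M K, (w n : ℂ) * z n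
      = (w K : ℂ) * ∑ n ∈ Finset.Ico M K, z n
        + ∑ n ∈ Finset.Ico M K, ((w n - w (n+1) : ℝ) : ℂ) * ∑ k ∈ Finset.Ico M (n+1), z k := by
    intro K hK
    induction K, hK using Nat.le_induction with
    | base => simp
    | succ K hK ih =>
      rw [Finset.sum_Ico_succ_top hK, ih, Finset.sum_Ico_succ_top hK, Finset.sum_Ico_succ_top hK]
      push_cast
      rw [Finset.sum_Ico_succ_top hK]
      ring
  have tele : ∀ K, M ≤ K → ∑ n ∈ Finset.Ico M K, (w n - w (n+1)) = w M - w K := by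
    intro K hK
    induction K, hK using Nat.le_induction with
    | base => simp
    | succ K hK ih => rw [Finset.sum_Ico_succ_top hK, ih]; ring
  rw [key N hMN]
  calc _ ≤ ‖(w N : ℂ) * ∑ n ∈ Finset.Ico M N, z n‖
        + ‖∑ n ∈ Finset.Ico M N, ((w n - w (n+1) : ℝ) : ℂ) * ∑ k ∈ Finset.Ico M (n+1), z k‖ :=
        norm_add_le _ _
    _ ≤ w N * B + ∑ n ∈ Finset.Ico M N, (w n - w (n+1)) * B := by
        gcongr
        · rw [norm_mul, Complex.norm_real, Real.norm_of_nonneg (hw0 N hMN)]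
          exact mul_le_mul_of_nonneg_left (hz N hMN le_rfl) (hw0 N hMN)
        · refine (norm_sum_le _ _).trans (Finset.sum_le_sum fun n hn => ?_)
          rw [Finset.mem_Ico] at hn
          have h1 : 0 ≤ w n - w (n+1) := sub_nonneg.2 (hw n hn.1)
          rw [norm_mul, Complex.norm_real, Real.norm_of_nonneg h1]
          exact mul_le_mul_of_nonneg_left (hz _ (by omega) (by omega)) h1
    _ = w M * B := by rw [← Finset.sum_mul, tele N hMN]; ring

/-- `e(t) = exp(2 π i t)`. -/
noncomputable def ee (t : ℝ) : ℂ := Complex.exp (2 * π * Complex.I * t)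

theorem ee_add (a b : ℝ) : ee (a + b) = ee a * ee b := by
  unfold ee; rw [← Complex.exp_add]; congr 1; push_cast; ring

theorem ee_norm (a : ℝ) : ‖ee a‖ = 1 := by
  unfold ee
  rw [show (2 * π * Complex.I * a : ℂ) = ((2 * π * a : ℝ) : ℂ) * Complex.I by push_cast; ring]
  exact Complex.norm_exp_ofReal_mul_I _

theorem ee_sub_one (a : ℝ) : ‖ee a - 1‖ = 2 * |Real.sin (π * a)| := by
  unfold ee
  rw [show (2 * π * Complex.I * a : ℂ) = Complex.I * ((2 * π * a : ℝ) : ℂ) by push_cast; ring,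
    Complex.norm_exp_I_mul_ofReal_sub_one, Real.norm_eq_abs, abs_mul, abs_two]
  congr 3; ring

theorem ee_sub_one_le (a : ℝ) : ‖ee a - 1‖ ≤ 2 * π * |a| := by
  rw [ee_sub_one]
  have := Real.abs_sin_le_abs (x := π * a)
  rw [abs_mul, abs_of_pos Real.pi_pos] at this
  linarith

theorem ee_sub_one_ge (a : ℝ) (ha : |a| ≤ 1/2) : 4 * |a| ≤ ‖ee a - 1‖ := by
  rw [ee_sub_one]
  have h := Real.mul_abs_le_abs_sin (x := π * a) (by
    rw [abs_mul, abs_of_pos Real.pi_pos]; nlinarith [Real.pi_pos])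
  rw [abs_mul, abs_of_pos Real.pi_pos] at h
  have : 2 / π * (π * |a|) = 2 * |a| := by field_simp
  linarith

theorem ee_neg_one : ee (-1) = 1 := by
  unfold ee
  rw [show (2 * π * Complex.I * ((-1 : ℝ) : ℂ) : ℂ) = -(2 * π * Complex.I) by push_cast; ring,
    Complex.exp_neg, Complex.exp_two_pi_mul_I, inv_one]

theorem ee_sub_one_ge' (a d : ℝ) (h1 : d ≤ a) (h2 : a ≤ 1 - d) (hd : 0 ≤ d) :
    4 * d ≤ ‖ee a - 1‖ := by
  by_cases h : a ≤ 1/2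
  · have := ee_sub_one_ge a (by rw [abs_of_nonneg (by linarith)]; exact h)
    rw [abs_of_nonneg (by linarith)] at this
    linarith
  · have hh := ee_sub_one_ge (a + (-1)) (by rw [abs_le]; constructor <;> linarith)
    rw [ee_add, ee_neg_one, mul_one, abs_of_nonpos (by linarith)] at hh
    linarith

/-- Kusmin-Landau type estimate for quadratic phases. -/
theorem kusmin (α h : ℝ) (d : ℕ → ℝ) (M N : ℕ) (hMN : M ≤ N)
    (hd : ∀ n, M ≤ n → n ≤ N → 0 < d n)
    (hg : ∀ n, M ≤ n → n ≤ N → 4 * d n ≤ ‖ee (α + h * (2 * n + 1)) - 1‖) :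
    ‖∑ n ∈ Finset.Ico M N, ee (α * n + h * n ^ 2)‖ ≤
      1 / (4 * d M) + 1 / (4 * d N)
        + ∑ n ∈ Finset.Ico M N, (π * |h| / 4) * (1 / (d n * d (n+1))) := by
  set z : ℕ → ℂ := fun n => ee (α * n + h * n ^ 2) with hz
  set r : ℕ → ℂ := fun n => ee (α + h * (2 * n + 1)) - 1 with hr
  set g : ℕ → ℂ := fun n => (r n)⁻¹ with hgd
  have zn : ∀ n, ‖z n‖ = 1 := fun n => ee_norm _
  have rpos : ∀ n, M ≤ n → n ≤ N → 0 < ‖r n‖ := fun n h1 h2 =>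
    lt_of_lt_of_le (by linarith [hd n h1 h2]) (hg n h1 h2)
  have zstep : ∀ n, z (n+1) - z n = r n * z n := by
    intro n
    simp only [hz, hr]
    rw [show α * ((n+1 : ℕ) : ℝ) + h * ((n+1 : ℕ) : ℝ)^2
      = (α + h * (2 * n + 1)) + (α * n + h * n^2) by push_cast; ring, ee_add]
    ring
  have key : ∀ K, M ≤ K → K ≤ N → ∑ n ∈ Finset.Ico M K, z n
      = g K * z K - g M * z M - ∑ n ∈ Finset.Ico M K, (g (n+1) - g n) * z (n+1) := by
    intro K hK
    induction K, hK using Nat.le_induction with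
    | base => simp
    | succ K hK ih =>
      intro hKN
      rw [Finset.sum_Ico_succ_top hK, ih (by omega), Finset.sum_Ico_succ_top hK]
      have h0 : r K ≠ 0 := norm_pos_iff.1 (rpos K hK (by omega))
      have h1 : z K = g K * (z (K+1) - z K) := by
        rw [zstep, hgd]; field_simp
      linear_combination h1
  have gb : ∀ n, M ≤ n → n ≤ N → ‖g n‖ ≤ 1 / (4 * d n) := by
    intro n h1 h2
    rw [hgd]; simp only [norm_inv]; rw [← one_div]
    exact one_div_le_one_div_of_le (by linarith [hd n h1 h2]) (hg n h1 h2)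
  rw [key N hMN le_rfl]
  calc _ ≤ ‖g N * z N‖ + ‖g M * z M‖ + ‖∑ n ∈ Finset.Ico M N, (g (n+1) - g n) * z (n+1)‖ :=
        (norm_sub_le _ _).trans (by gcongr; exact norm_sub_le _ _)
    _ ≤ 1 / (4 * d N) + 1 / (4 * d M)
        + ∑ n ∈ Finset.Ico M N, (π * |h| / 4) * (1 / (d n * d (n+1))) := by
        gcongr
        · rw [norm_mul, zn, mul_one]; exact gb N hMN le_rfl
        · rw [norm_mul, zn, mul_one]; exact gb M le_rfl hMN
        · refine (norm_sum_le _ _).trans (Finset.sum_le_sum fun n hn => ?_)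
          rw [Finset.mem_Ico] at hn
          have p1 := rpos n hn.1 (by omega)
          have p2 := rpos (n+1) (by omega) (by omega)
          have n1 : r n ≠ 0 := norm_pos_iff.1 p1
          have n2 : r (n+1) ≠ 0 := norm_pos_iff.1 p2
          rw [norm_mul, zn, mul_one]
          have e : g (n+1) - g n = (r n - r (n+1)) / (r n * r (n+1)) := by
            simp only [hgd]; field_simp
          have e2 : r n - r (n+1) = - (ee (α + h * (2 * n + 1)) * (ee (2 * h) - 1)) := by
            simp only [hr]
            rw [show α + h * (2 * ((n+1 : ℕ) : ℝ) + 1) = (α + h * (2 * n + 1)) + 2 * h by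
              push_cast; ring, ee_add (α + h * (2 * n + 1)) (2 * h)]
            ring
          have e3 : ‖r n - r (n+1)‖ ≤ 4 * π * |h| := by
            rw [e2, norm_neg, norm_mul, ee_norm, one_mul]
            refine (ee_sub_one_le _).trans ?_
            rw [abs_mul, abs_two]; linarith
          rw [e, norm_div, norm_mul]
          have d1 := hd n hn.1 (by omega)
          have d2 := hd (n+1) (by omega) (by omega)
          have m : (4 * d n) * (4 * d (n+1)) ≤ ‖r n‖ * ‖r (n+1)‖ :=
            mul_le_mul (hg n hn.1 (by omega)) (hg (n+1) (by omega) (by omega)) (by linarith) p1.le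
          calc _ ≤ (4 * π * |h|) / ((4 * d n) * (4 * d (n+1))) := by
                have := Real.pi_pos
                gcongr
            _ = _ := by field_simp
    _ = _ := by ring

/-- Quadratic Gauss sum with linear term. -/
noncomputable def Gs (q : ℕ) [NeZero q] (p m : ZMod q) : ℂ :=
  ∑ r : ZMod q, ZMod.stdAddChar (p * r ^ 2 - m * r)

theorem std_norm (q : ℕ) [NeZero q] (a : ZMod q) : ‖(ZMod.stdAddChar a : ℂ)‖ = 1 := by
  rw [ZMod.stdAddChar_apply]; exact Circle.norm_coe _

theorem std_conj (q : ℕ) [NeZero q] (a : ZMod q) :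
    (starRingEnd ℂ) (ZMod.stdAddChar a : ℂ) = ZMod.stdAddChar (-a) := by
  rw [AddChar.map_neg_eq_inv, Complex.inv_def, Complex.normSq_eq_norm_sq, std_norm]; simp

theorem two_torsion_card (q : ℕ) [NeZero q] :
    (Finset.univ.filter (fun d : ZMod q => 2 * d = 0)).card ≤ 2 := by
  have : (Finset.univ.filter (fun d : ZMod q => 2 * d = 0)) ⊆ {0, ((q/2 : ℕ) : ZMod q)} := by
    intro d hd
    simp only [Finset.mem_filter, Finset.mem_univ, true_and] at hd
    simp only [Finset.mem_insert, Finset.mem_singleton]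
    have hv : (d.val : ZMod q) = d := ZMod.natCast_zmod_val d
    have hlt := ZMod.val_lt d
    rw [← hv] at hd
    have hd' : ((2 * d.val : ℕ) : ZMod q) = 0 := by push_cast; exact hd
    rw [ZMod.natCast_eq_zero_iff] at hd'
    obtain ⟨k, hk⟩ := hd'
    have hk2 : k < 2 := by
      by_contra hcon
      have : q * 2 ≤ q * k := Nat.mul_le_mul_left _ (by omega)
      omega
    interval_cases k
    · left; rw [← hv, show d.val = 0 by omega]; simp
    · right; rw [← hv]; congr 1; omega
  exact (Finset.card_le_card this).trans Finset.card_le_two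

theorem Gs_norm (q : ℕ) [NeZero q] (p m : ZMod q) (hp : IsUnit p) :
    ‖Gs q p m‖ ≤ √(2 * q) := by
  apply Real.le_sqrt_of_sq_le
  have h1 : ((‖Gs q p m‖ ^ 2 : ℝ) : ℂ) = Gs q p m * (starRingEnd ℂ) (Gs q p m) := by
    rw [Complex.mul_conj, Complex.normSq_eq_norm_sq]
  have h2 : Gs q p m * (starRingEnd ℂ) (Gs q p m) =
      ∑ d : ZMod q, ZMod.stdAddChar (p * d ^ 2 - m * d) *
        (if 2 * p * d = 0 then (Fintype.card (ZMod q) : ℂ) else 0) := by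
    have : ∀ d : ZMod q, (if 2 * p * d = 0 then (Fintype.card (ZMod q) : ℂ) else 0)
        = ∑ t : ZMod q, ZMod.stdAddChar (t * (2 * p * d)) := by
      intro d
      rw [AddChar.sum_mulShift _ (ZMod.isPrimitive_stdAddChar q)]
      split_ifs <;> simp
    simp_rw [this, Finset.mul_sum]
    rw [Finset.sum_comm]
    unfold Gs
    rw [map_sum, Finset.mul_sum]
    refine Finset.sum_congr rfl fun t _ => ?_
    rw [Finset.sum_mul, ← Equiv.sum_comp (Equiv.addLeft t)]
    refine Finset.sum_congr rfl fun d _ => ?_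
    rw [std_conj, ← AddChar.map_add_eq_mul, ← AddChar.map_add_eq_mul]
    congr 1
    simp only [Equiv.coe_addLeft]
    ring
  have h3 : ‖Gs q p m * (starRingEnd ℂ) (Gs q p m)‖ ≤ 2 * q := by
    rw [h2]
    refine (norm_sum_le _ _).trans ?_
    have : ∀ d : ZMod q, ‖(ZMod.stdAddChar (p * d ^ 2 - m * d) : ℂ) *
        (if 2 * p * d = 0 then (Fintype.card (ZMod q) : ℂ) else 0)‖ =
        if 2 * d = 0 then (q : ℝ) else 0 := by
      intro d
      rw [norm_mul, std_norm, one_mul, ZMod.card]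
      have : 2 * p * d = 0 ↔ 2 * d = 0 := by
        rw [show 2 * p * d = p * (2 * d) by ring]
        exact hp.mul_right_eq_zero
      simp only [this]
      split_ifs <;> simp
    simp_rw [this]
    rw [← Finset.sum_filter, Finset.sum_const, nsmul_eq_mul]
    have := two_torsion_card q
    gcongr
    exact_mod_cast this
  rw [← h1, Complex.norm_real, Real.norm_of_nonneg (by positivity)] at h3
  exact h3

theorem Gs_zero (q : ℕ) [NeZero q] (p : ℤ) (hp : IsCoprime p (q : ℤ)) (h : q % 4 = 2) :
    Gs q (p : ZMod q) 0 = 0 := by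
  obtain ⟨k, hk⟩ : ∃ k, q = 2 * k := ⟨q / 2, by omega⟩
  have hk2 : (2 : ZMod q) * (k : ZMod q) = 0 := by
    have : ((2 * k : ℕ) : ZMod q) = 0 := by rw [← hk]; simp
    simpa using this
  have hc : ((p : ZMod q) * (k : ZMod q) ^ 2) ≠ 0 := by
    intro h0
    have : ((p * (k : ℤ) ^ 2 : ℤ) : ZMod q) = 0 := by push_cast; exact h0
    rw [ZMod.intCast_zmod_eq_zero_iff_dvd] at this
    have h2q : (2 : ℤ) ∣ q := ⟨k, by rw [hk]; push_cast; ring⟩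
    have h2 : (2 : ℤ) ∣ p * (k : ℤ) ^ 2 := h2q.trans this
    rcases Int.prime_two.dvd_or_dvd h2 with h2 | h2
    · have := hp.isUnit_of_dvd' h2 h2q
      rw [Int.isUnit_iff] at this; omega
    · have := Int.prime_two.dvd_of_dvd_pow h2
      omega
  have hψ : (ZMod.stdAddChar ((p : ZMod q) * (k : ZMod q) ^ 2) : ℂ) ≠ 1 := by
    intro h1
    apply hc
    apply ZMod.injective_stdAddChar (N := q)
    rw [h1, AddChar.map_zero_eq_one]
  have : Gs q (p : ZMod q) 0 = ZMod.stdAddChar ((p : ZMod q) * (k : ZMod q) ^ 2) * Gs q (p : ZMod q) 0 := by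
    conv_lhs => unfold Gs
    rw [← Equiv.sum_comp (Equiv.addRight (k : ZMod q))]
    unfold Gs
    rw [Finset.mul_sum]
    refine Finset.sum_congr rfl fun r _ => ?_
    rw [← AddChar.map_add_eq_mul]
    congr 1
    simp only [Equiv.coe_addRight]
    linear_combination (p : ZMod q) * r * hk2
  have h' : (1 - (ZMod.stdAddChar ((p : ZMod q) * (k : ZMod q) ^ 2) : ℂ)) * Gs q (p : ZMod q) 0 = 0 := by
    linear_combination this
  rcases mul_eq_zero.1 h' with h' | h'
  · exact absurd (sub_eq_zero.1 h').symm hψ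
  · exact h'

theorem Gs_inv (q : ℕ) [NeZero q] (p n : ZMod q) :
    (q : ℂ) * ZMod.stdAddChar (p * n ^ 2) = ∑ m : ZMod q, Gs q p m * ZMod.stdAddChar (m * n) := by
  unfold Gs
  simp_rw [Finset.sum_mul]
  rw [Finset.sum_comm]
  have : ∀ r : ZMod q, ∑ m : ZMod q, (ZMod.stdAddChar (p * r ^ 2 - m * r) : ℂ) * ZMod.stdAddChar (m * n)
      = if n = r then (q : ℂ) * ZMod.stdAddChar (p * r ^ 2) else 0 := by
    intro r
    have : ∀ m : ZMod q, (ZMod.stdAddChar (p * r ^ 2 - m * r) : ℂ) * ZMod.stdAddChar (m * n)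
      = ZMod.stdAddChar (p * r ^ 2) * ZMod.stdAddChar (m * (n - r)) := by
      intro m
      rw [← AddChar.map_add_eq_mul, ← AddChar.map_add_eq_mul]
      congr 1; ring
    simp_rw [this]
    rw [← Finset.mul_sum, AddChar.sum_mulShift _ (ZMod.isPrimitive_stdAddChar q)]
    simp only [sub_eq_zero, ZMod.card]
    split_ifs <;> simp [mul_comm]
  simp_rw [this]
  simp

theorem std_ee (q : ℕ) [NeZero q] (j : ℤ) : (ZMod.stdAddChar (j : ZMod q) : ℂ) = ee (j / q) := by
  rw [ZMod.stdAddChar_coe]; unfold ee; congr 1; push_cast; ring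

theorem sum_zmod_range (q : ℕ) [NeZero q] (f : ZMod q → ℂ) :
    ∑ m : ZMod q, f m = ∑ k ∈ Finset.range q, f (k : ZMod q) := by
  refine Finset.sum_bij' (fun m _ => m.val) (fun k _ => (k : ZMod q)) ?_ ?_ ?_ ?_ ?_
  · intro m _; exact Finset.mem_range.2 (ZMod.val_lt m)
  · intro _ _; exact Finset.mem_univ _
  · intro m _; exact ZMod.natCast_zmod_val m
  · intro k hk; exact ZMod.val_cast_of_lt (Finset.mem_range.1 hk)
  · intro m _; rw [ZMod.natCast_zmod_val]

/-- The finite Fourier expansion, in terms of `ee`. -/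
theorem ee_expand (q : ℕ) [NeZero q] (p : ℤ) (n : ℕ) :
    (q : ℂ) * ee ((p : ℝ) * (n : ℝ) ^ 2 / q) =
      ∑ k ∈ Finset.range q, Gs q (p : ZMod q) (k : ZMod q) * ee ((k : ℝ) / q * n) := by
  have h := Gs_inv q (p : ZMod q) (n : ZMod q)
  rw [sum_zmod_range] at h
  have e1 : (ZMod.stdAddChar ((p : ZMod q) * (n : ZMod q) ^ 2) : ℂ) = ee ((p : ℝ) * (n : ℝ) ^ 2 / q) := by
    rw [show ((p : ZMod q) * (n : ZMod q) ^ 2) = ((p * (n : ℤ) ^ 2 : ℤ) : ZMod q) by push_cast; rfl, std_ee]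
    congr 1; push_cast; ring
  rw [← e1, h]
  refine Finset.sum_congr rfl fun k _ => ?_
  congr 1
  rw [show ((k : ZMod q) * (n : ZMod q)) = (((k : ℤ) * (n : ℤ) : ℤ) : ZMod q) by push_cast; rfl, std_ee]
  congr 1; push_cast; ring

theorem cfX_irr (x : ℝ) (hirr : Irrational x) (hx : x ∈ Set.Ioo (0:ℝ) 1) (j : ℕ) :
    Irrational (cfX x j) ∧ 0 < cfX x j ∧ cfX x j < 1 := by
  induction j with
  | zero => exact ⟨hirr, hx.1, hx.2⟩
  | succ j ih =>
    have h1 : Irrational (cfX x (j+1)) := by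
      have h2 : Irrational ((cfX x j)⁻¹) := ih.1.inv
      show Irrational (Int.fract (cfX x j)⁻¹)
      unfold Int.fract
      exact h2.sub_intCast _
    refine ⟨h1, lt_of_le_of_ne (Int.fract_nonneg _) (h1.ne_zero).symm, Int.fract_lt_one _⟩

theorem cfA_pos (x : ℝ) (hirr : Irrational x) (hx : x ∈ Set.Ioo (0:ℝ) 1) (j : ℕ) :
    1 ≤ cfA x j := by
  obtain ⟨_, h0, h1⟩ := cfX_irr x hirr hx j
  unfold cfA
  rw [Int.le_floor]
  push_cast
  exact (one_le_inv₀ h0).2 h1.le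

theorem cfQ_pos (x : ℝ) (hirr : Irrational x) (hx : x ∈ Set.Ioo (0:ℝ) 1) (j : ℕ) :
    1 ≤ cfQ x j ∧ cfQ x j ≤ cfQ x (j+1) := by
  induction j with
  | zero => exact ⟨le_rfl, cfA_pos x hirr hx 0⟩
  | succ j ih =>
    have h1 : 1 ≤ cfQ x (j+1) := ih.1.trans ih.2
    refine ⟨h1, ?_⟩
    show cfQ x (j+1) ≤ cfA x (j + 1) * cfQ x (j + 1) + cfQ x j
    nlinarith [cfA_pos x hirr hx (j+1)]

theorem cfQ_two (x : ℝ) (hirr : Irrational x) (hx : x ∈ Set.Ioo (0:ℝ) 1) (j : ℕ) :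
    2 * cfQ x j ≤ cfQ x (j+2) := by
  have h0 := cfQ_pos x hirr hx j
  show 2 * cfQ x j ≤ cfA x (j + 1) * cfQ x (j + 1) + cfQ x j
  nlinarith [cfA_pos x hirr hx (j+1)]

theorem cfQ_growth (x : ℝ) (hirr : Irrational x) (hx : x ∈ Set.Ioo (0:ℝ) 1) (j : ℕ) :
    (2:ℝ) ^ j ≤ 2 * (cfQ x j : ℝ) ^ 2 ∧ (2:ℝ) ^ (j+1) ≤ 2 * (cfQ x (j+1) : ℝ) ^ 2 := by
  induction j with
  | zero =>
    have h0 : (1:ℝ) ≤ cfQ x 0 := by exact_mod_cast (cfQ_pos x hirr hx 0).1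
    have h1 : (1:ℝ) ≤ cfQ x 1 := by exact_mod_cast (cfQ_pos x hirr hx 1).1
    constructor
    · rw [pow_zero]; nlinarith
    · rw [zero_add, pow_one]; nlinarith
  | succ j ih =>
    refine ⟨ih.2, ?_⟩
    have h0 : (1:ℝ) ≤ cfQ x j := by exact_mod_cast (cfQ_pos x hirr hx j).1
    have h1 : 2 * (cfQ x j : ℝ) ≤ cfQ x (j+2) := by exact_mod_cast cfQ_two x hirr hx j
    have : (2:ℝ) ^ (j+1+1) = 4 * 2 ^ j := by ring
    rw [this]
    show _ ≤ 2 * (cfQ x (j+2) : ℝ) ^ 2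
    nlinarith [ih.1]

theorem cf_det (x : ℝ) (j : ℕ) :
    cfP x (j+1) * cfQ x j - cfP x j * cfQ x (j+1) = (-1) ^ j := by
  induction j with
  | zero => simp [cfP, cfQ]
  | succ j ih =>
    show (cfA x (j + 1) * cfP x (j + 1) + cfP x j) * cfQ x (j+1)
      - cfP x (j+1) * (cfA x (j + 1) * cfQ x (j + 1) + cfQ x j) = _
    rw [pow_succ, ← ih]; ring

theorem cf_coprime (x : ℝ) (j : ℕ) : IsCoprime (cfP x j) (cfQ x j) := by
  have h := cf_det x j
  have h2 : ((-1 : ℤ) ^ j) * (-1) ^ j = 1 := by rw [← mul_pow]; simp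
  refine ⟨-(cfQ x (j+1)) * (-1)^j, cfP x (j+1) * (-1)^j, ?_⟩
  linear_combination (-1)^j * h + h2

theorem cf_complete (x : ℝ) (hirr : Irrational x) (hx : x ∈ Set.Ioo (0:ℝ) 1) (j : ℕ) :
    x * (cfQ x (j+1) + cfX x (j+1) * cfQ x j) = cfP x (j+1) + cfX x (j+1) * cfP x j := by
  have step : ∀ i, (cfX x i) * (cfA x i + cfX x (i+1)) = 1 := by
    intro i
    have h0 := (cfX_irr x hirr hx i).2.1
    show (cfX x i) * ((⌊(cfX x i)⁻¹⌋ : ℝ) + Int.fract (cfX x i)⁻¹) = 1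
    rw [Int.floor_add_fract]
    exact mul_inv_cancel₀ h0.ne'
  induction j with
  | zero =>
    have := step 0
    simp only [cfP, cfQ]
    have e : cfX x 0 = x := rfl
    rw [e] at this
    push_cast
    linear_combination this
  | succ j ih =>
    have h0 := (cfX_irr x hirr hx (j+1)).2.1
    have hs := step (j+1)
    have eP : (cfP x (j+1+1) : ℝ) = cfA x (j + 1) * cfP x (j + 1) + cfP x j := by
      simp [cfP]
    have eQ : (cfQ x (j+1+1) : ℝ) = cfA x (j + 1) * cfQ x (j + 1) + cfQ x j := by
      simp [cfQ]
    rw [eP, eQ]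
    apply mul_left_cancel₀ h0.ne'
    linear_combination ih + (x * cfQ x (j+1) - cfP x (j+1)) * hs

theorem cfH_bounds (x : ℝ) (hirr : Irrational x) (hx : x ∈ Set.Ioo (0:ℝ) 1) (j : ℕ) :
    1 / (2 * ((cfQ x j : ℝ) * cfQ x (j+1))) ≤ |cfH x j| ∧
    |cfH x j| ≤ 1 / ((cfQ x j : ℝ) * cfQ x (j+1)) := by
  have h0 : (1:ℝ) ≤ cfQ x j := by exact_mod_cast (cfQ_pos x hirr hx j).1
  have h1 : (cfQ x j : ℝ) ≤ cfQ x (j+1) := by exact_mod_cast (cfQ_pos x hirr hx j).2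
  obtain ⟨_, hX0, hX1⟩ := cfX_irr x hirr hx (j+1)
  have hc := cf_complete x hirr hx j
  have hdet : (cfP x (j+1) : ℝ) * cfQ x j - cfP x j * cfQ x (j+1) = (-1) ^ j := by
    exact_mod_cast cf_det x j
  set D : ℝ := cfQ x (j+1) + cfX x (j+1) * cfQ x j with hD
  have hD1 : (cfQ x (j+1) : ℝ) ≤ D := by rw [hD]; nlinarith
  have hD2 : D ≤ 2 * cfQ x (j+1) := by rw [hD]; nlinarith
  have hDp : 0 < D := by linarith
  have hH : cfH x j = (-1) ^ j / (cfQ x j * D) := by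
    unfold cfH
    have : (cfQ x j : ℝ) ≠ 0 := by linarith
    field_simp
    rw [← hdet]
    linear_combination (cfQ x j : ℝ) * hc + (cfP x j : ℝ) * hD * 0 - (cfP x j : ℝ) * hD
  have hab : |cfH x j| = 1 / (cfQ x j * D) := by
    rw [hH, abs_div, abs_pow, abs_neg, abs_one, one_pow, abs_of_pos (by positivity)]
  rw [hab]
  have hq : (0:ℝ) < cfQ x j := by linarith
  have hq' : (0:ℝ) < cfQ x (j+1) := by linarith
  constructor
  · apply one_div_le_one_div_of_le (by positivity)
    nlinarith
  · apply one_div_le_one_div_of_le (by positivity)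
    nlinarith

theorem W_ne (k q : ℕ) (q' h : ℝ) (hk : 1 ≤ k) (hkq : k < q) (hq' : 0 < q')
    (hh : |h| ≤ 1 / (q * q')) (M N : ℕ) (hM : 1 ≤ M) (hMN : M ≤ N) (hN : 6 * (N : ℝ) ≤ q') :
    ‖∑ n ∈ Finset.Ico M N, ee ((k : ℝ) / q * n + h * n ^ 2)‖ ≤ 2 * q * (1 / k + 1 / ((q : ℝ) - k)) := by
  have hk' : (1 : ℝ) ≤ k := by exact_mod_cast hk
  have hkq' : (k : ℝ) + 1 ≤ q := by exact_mod_cast hkq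
  have hq0 : (0:ℝ) < q := by linarith
  have hN1 : (1 : ℝ) ≤ N := by exact_mod_cast hM.trans hMN
  set μ : ℝ := min (k : ℝ) (q - k) with hμ
  have hμ1 : 1 ≤ μ := le_min hk' (by linarith)
  have hμk : μ ≤ k := min_le_left _ _
  have hμk' : μ ≤ q - k := min_le_right _ _
  set δ : ℝ := μ / (2 * q) with hδ
  have hδ0 : 0 < δ := by positivity
  have hNh : |h| * N ≤ 1 / (6 * q) := by
    calc |h| * N ≤ 1 / (q * q') * (q' / 6) := by
          apply mul_le_mul hh (by linarith) (by linarith) (by positivity)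
      _ = _ := by field_simp
  have hsm : ∀ n : ℕ, n ≤ N → |h * (2 * n + 1)| ≤ 1 / (2 * q) := by
    intro n hn
    have hn' : (n : ℝ) ≤ N := by exact_mod_cast hn
    rw [abs_mul, abs_of_nonneg (by positivity : (0:ℝ) ≤ 2 * n + 1)]
    calc |h| * (2 * n + 1) ≤ |h| * (3 * N) := by gcongr; linarith
      _ = 3 * (|h| * N) := by ring
      _ ≤ 3 * (1 / (6 * q)) := by gcongr
      _ = _ := by field_simp; norm_num
  have h12 : 1 / (2 * (q : ℝ)) ≤ δ := by rw [hδ]; gcongr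
  have hb := kusmin (k / q) h (fun _ => δ) M N hMN (fun _ _ _ => hδ0) (by
    intro n _ hn
    have h1 := abs_le.1 (hsm n hn)
    have h2 : 2 * δ ≤ k / q := by
      rw [hδ, show 2 * (μ / (2 * (q:ℝ))) = μ / q by field_simp]; gcongr
    have h3 : 2 * δ ≤ 1 - k / q := by
      rw [hδ, show 2 * (μ / (2 * (q:ℝ))) = μ / q by field_simp,
        show 1 - (k : ℝ) / q = (q - k) / q by field_simp]; gcongr
    apply ee_sub_one_ge' _ _ _ _ hδ0.le <;> linarith [h1.1, h1.2])
  have hinv : 1 / δ ≤ 2 * q * (1 / k + 1 / ((q : ℝ) - k)) := by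
    have : 1 / μ ≤ 1 / k + 1 / ((q : ℝ) - k) := by
      have a1 : 0 ≤ 1 / (k : ℝ) := by positivity
      have a2 : 0 ≤ 1 / ((q : ℝ) - k) := one_div_nonneg.2 (by linarith)
      rcases min_choice (k : ℝ) (q - k) with e | e <;> rw [hμ, e] <;> linarith
    rw [hδ, one_div_div, div_eq_mul_one_div]
    gcongr
  refine hb.trans (le_trans ?_ hinv)
  rw [Finset.sum_const, Nat.card_Ico, nsmul_eq_mul]
  have hNM : ((N - M : ℕ) : ℝ) ≤ N := by exact_mod_cast Nat.sub_le _ _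
  have hpi := Real.pi_le_four
  have hpi0 := Real.pi_pos
  have : ((N - M : ℕ) : ℝ) * (π * |h| / 4 * (1 / (δ * δ))) ≤ 1 / δ * (1 / 3) := by
    calc _ ≤ (N : ℝ) * (4 * |h| / 4 * (1 / (δ * δ))) := by gcongr
      _ = (|h| * N) * (1 / (δ * δ)) := by ring
      _ ≤ (δ * (1/3)) * (1 / (δ * δ)) := by
          apply mul_le_mul_of_nonneg_right _ (by positivity)
          refine hNh.trans ?_
          rw [show 1 / (6 * (q:ℝ)) = 1 / (2 * q) * (1/3) by field_simp; norm_num]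
          gcongr
      _ = _ := by field_simp
  have e : 1 / (4 * δ) = 1 / δ * (1/4) := by field_simp
  have : 0 ≤ 1 / δ := by positivity
  simp only [e]
  linarith

theorem W_zero (h : ℝ) (h0 : 0 < |h|) (M N : ℕ) (hM : 1 ≤ M) (hMN : M ≤ N)
    (hN : |h| * (2 * N + 1) ≤ 1 / 2) :
    ‖∑ n ∈ Finset.Ico M N, ee (h * n ^ 2)‖ ≤ 1 / (|h| * M) := by
  have hM' : (1 : ℝ) ≤ M := by exact_mod_cast hM
  have hMN' : (M : ℝ) ≤ N := by exact_mod_cast hMN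
  have hb := kusmin 0 h (fun n => |h| * (2 * n + 1)) M N hMN (fun _ _ _ => by positivity) (by
    intro n _ hn
    have hn' : (n : ℝ) ≤ N := by exact_mod_cast hn
    have e : |h * (2 * n + 1)| = |h| * (2 * n + 1) := by
      rw [abs_mul, abs_of_nonneg (by positivity : (0:ℝ) ≤ 2 * n + 1)]
    rw [zero_add, ← e]
    apply ee_sub_one_ge
    rw [e]
    refine le_trans ?_ hN
    gcongr)
  simp only [zero_mul, zero_add] at hb
  refine hb.trans ?_
  have tele : ∀ K, M ≤ K → ∑ n ∈ Finset.Ico M K, (π * |h| / 4) *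
      (1 / (|h| * (2 * n + 1) * (|h| * (2 * ((n+1 : ℕ) : ℝ) + 1))))
      = (π / (8 * |h|)) * (1 / (2 * M + 1) - 1 / (2 * K + 1)) := by
    intro K hK
    induction K, hK using Nat.le_induction with
    | base => simp
    | succ K hK ih =>
      rw [Finset.sum_Ico_succ_top hK, ih]
      push_cast
      field_simp
      ring
  rw [tele N hMN]
  have hpi := Real.pi_le_four
  have hpi0 := Real.pi_pos
  have a1 : (π / (8 * |h|)) * (1 / (2 * M + 1) - 1 / (2 * N + 1)) ≤ 4 / (8 * |h|) * (1 / (2 * M)) := by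
    have : (0:ℝ) ≤ 1 / (2 * N + 1) := by positivity
    have : (1:ℝ) / (2 * M + 1) ≤ 1 / (2 * M) := by gcongr; linarith
    calc _ ≤ (π / (8 * |h|)) * (1 / (2 * M)) := by gcongr; linarith
      _ ≤ _ := by gcongr
  have a2 : 1 / (4 * (|h| * (2 * (M:ℝ) + 1))) ≤ 1 / (4 * (|h| * (2 * M))) := by gcongr; linarith
  have a3 : 1 / (4 * (|h| * (2 * (N:ℝ) + 1))) ≤ 1 / (4 * (|h| * (2 * M))) := by gcongr; linarith
  have e1 : 4 / (8 * |h|) * (1 / (2 * (M:ℝ))) = 1 / (|h| * M) * (1/4) := by field_simp; norm_num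
  have e2 : 1 / (4 * (|h| * (2 * (M:ℝ)))) = 1 / (|h| * M) * (1/8) := by field_simp; norm_num
  have : 0 ≤ 1 / (|h| * M) := by positivity
  linarith

theorem harm_bound (q : ℕ) (hq : 1 ≤ q) :
    ∑ k ∈ Finset.Ico 1 q, (1 / (k : ℝ) + 1 / ((q : ℝ) - k)) ≤ 2 * (1 + Real.log q) := by
  have h1 : ∑ k ∈ Finset.Ico 1 q, (1 / (k : ℝ)) ≤ 1 + Real.log q := by
    have := harmonic_le_one_add_log q
    rw [harmonic_eq_sum_Icc] at this
    push_cast at this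
    refine le_trans ?_ this
    simp only [one_div]
    apply Finset.sum_le_sum_of_subset_of_nonneg
    · intro a; simp only [Finset.mem_Ico, Finset.mem_Icc]; omega
    · intros; positivity
  have h2 : ∑ k ∈ Finset.Ico 1 q, (1 / ((q : ℝ) - k)) = ∑ k ∈ Finset.Ico 1 q, (1 / (k : ℝ)) := by
    refine Finset.sum_bij' (fun k _ => q - k) (fun k _ => q - k) ?_ ?_ ?_ ?_ ?_ <;>
      intro a ha <;> rw [Finset.mem_Ico] at ha
    · rw [Finset.mem_Ico]; omega
    · rw [Finset.mem_Ico]; omega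
    · show q - (q - a) = a
      omega
    · show q - (q - a) = a
      omega
    · rw [Nat.cast_sub (by omega)]
  rw [Finset.sum_add_distrib, h2]
  linarith

theorem w_anti (s : ℝ) (hs : 0 ≤ s) (M : ℕ) (hM : 1 ≤ M) (n : ℕ) (hn : M ≤ n) :
    ((n + 1 : ℕ) : ℝ) ^ (-s) ≤ (n : ℝ) ^ (-s) := by
  have : (0:ℝ) < n := by exact_mod_cast (by omega : 0 < n)
  apply Real.rpow_le_rpow_of_nonpos this (by push_cast; linarith) (by linarith)

theorem block_est (s : ℝ) (hs : 0 ≤ s) (q : ℕ) [NeZero q] (p : ℤ) (hp : IsCoprime p (q : ℤ))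
    (q' h x : ℝ) (hq' : 0 < q') (hx : x = p / q + h)
    (hh : |h| ≤ 1 / (q * q')) (M N : ℕ) (hM : 1 ≤ M) (hMN : M ≤ N) (hN : 6 * (N : ℝ) ≤ q') :
    ‖∑ n ∈ Finset.Ico M N, (((n : ℝ) ^ (-s) : ℝ) : ℂ) * ee (x * n ^ 2)‖ ≤
      (M : ℝ) ^ (-s) * (4 * √(2 * q) * (1 + Real.log q)) +
      ‖Gs q (p : ZMod q) 0‖ / q *
        ‖∑ n ∈ Finset.Ico M N, (((n : ℝ) ^ (-s) : ℝ) : ℂ) * ee (h * n ^ 2)‖ := by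
  have hq1 : 1 ≤ q := NeZero.one_le
  have hq0 : (0:ℝ) < q := by exact_mod_cast hq1
  have hqc : (q : ℂ) ≠ 0 := by exact_mod_cast hq0.ne'
  have hunit : IsUnit (p : ZMod q) := by
    obtain ⟨a, b, hab⟩ := hp
    refine IsUnit.of_mul_eq_one (a : ZMod q) ?_
    have := congrArg (fun t : ℤ => (t : ZMod q)) hab
    push_cast at this
    simp only [ZMod.natCast_self, mul_zero, add_zero] at this
    rw [mul_comm]; exact this
  set W : ℕ → ℂ := fun k => ∑ n ∈ Finset.Ico M N, (((n : ℝ) ^ (-s) : ℝ) : ℂ) *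
    ee ((k : ℝ) / q * n + h * n ^ 2) with hW
  have hW0 : ∑ n ∈ Finset.Ico M N, (((n : ℝ) ^ (-s) : ℝ) : ℂ) * ee (h * n ^ 2) = W 0 := by
    simp [hW]
  have hexp : (q : ℂ) * ∑ n ∈ Finset.Ico M N, (((n : ℝ) ^ (-s) : ℝ) : ℂ) * ee (x * n ^ 2)
      = ∑ k ∈ Finset.range q, Gs q (p : ZMod q) (k : ZMod q) * W k := by
    simp only [hW, Finset.mul_sum]
    rw [Finset.sum_comm]
    refine Finset.sum_congr rfl fun n _ => ?_
    have e : ee (x * n ^ 2) = ee ((p : ℝ) * (n : ℝ) ^ 2 / q) * ee (h * n ^ 2) := by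
      rw [← ee_add, hx]; congr 1; ring
    have := ee_expand q p n
    calc _ = (((n : ℝ) ^ (-s) : ℝ) : ℂ) * ee (h * n ^ 2) * ((q : ℂ) * ee ((p : ℝ) * (n : ℝ) ^ 2 / q)) := by
          rw [e]; ring
      _ = _ := by
          rw [this, Finset.mul_sum]
          refine Finset.sum_congr rfl fun k _ => ?_
          rw [ee_add]; ring
  have hWk : ∀ k ∈ Finset.Ico 1 q, ‖Gs q (p : ZMod q) (k : ZMod q) * W k‖ ≤
      √(2 * q) * ((M : ℝ) ^ (-s) * (2 * q * (1 / k + 1 / ((q : ℝ) - k)))) := by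
    intro k hk
    rw [Finset.mem_Ico] at hk
    rw [norm_mul]
    apply mul_le_mul (Gs_norm q _ _ hunit) _ (norm_nonneg _) (Real.sqrt_nonneg _)
    apply abel_bound _ (fun n => (n : ℝ) ^ (-s)) M _ (fun n _ => by positivity)
      (fun n hn => w_anti s hs M hM n hn) N hMN
    intro K hMK hKN
    have hKN' : (K : ℝ) ≤ N := by exact_mod_cast hKN
    exact W_ne k q q' h hk.1 hk.2 hq' hh M K hM hMK (by linarith)
  rw [hW0]
  have key : ‖(q : ℂ) * ∑ n ∈ Finset.Ico M N, (((n : ℝ) ^ (-s) : ℝ) : ℂ) * ee (x * n ^ 2)‖ ≤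
      ‖Gs q (p : ZMod q) 0‖ * ‖W 0‖ + √(2 * q) * ((M : ℝ) ^ (-s) * (2 * q * (2 * (1 + Real.log q)))) := by
    rw [hexp, Finset.range_eq_Ico, Finset.sum_eq_sum_Ico_succ_bot (by omega)]
    refine (norm_add_le _ _).trans ?_
    gcongr
    · rw [norm_mul]; simp
    · refine (norm_sum_le _ _).trans ((Finset.sum_le_sum hWk).trans ?_)
      rw [← Finset.mul_sum, ← Finset.mul_sum, ← Finset.mul_sum]
      gcongr
      exact harm_bound q hq1
  rw [norm_mul, Complex.norm_natCast] at key
  rw [← mul_le_mul_iff_right₀ hq0]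
  refine key.trans (le_of_eq ?_)
  field_simp
  ring

/-- The bound for the non oscillating part. -/
noncomputable def Ibd (s q R : ℝ) : ℝ := if s < 1 then R ^ (1 - s) / (1 - s) else Real.log (12 * R / q)

theorem sumA (s : ℝ) (hs : 1/2 < s) (hs1 : s ≤ 1) (q R : ℝ) (hq : 0 < q) (hR : q ≤ R)
    (M K : ℕ) (hM : 1 ≤ M) (hqM : q ≤ 12 * M) (hK : K ≤ M ∨ (K : ℝ) ≤ R + 1) :
    ∑ n ∈ Finset.Ico M K, (n : ℝ) ^ (-s) ≤ (M : ℝ) ^ (-s) + Ibd s q R := by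
  have hM' : (1 : ℝ) ≤ M := by exact_mod_cast hM
  have hI : 0 ≤ Ibd s q R := by
    unfold Ibd
    split_ifs with h
    · have : 0 < 1 - s := by linarith
      have : 0 < R := by linarith
      positivity
    · apply Real.log_nonneg
      rw [le_div_iff₀ hq]; linarith
  by_cases hKM : K ≤ M
  · rw [Finset.Ico_eq_empty (by omega), Finset.sum_empty]
    positivity
  have hK' : (K : ℝ) ≤ R + 1 := by
    rcases hK with h | h
    · exact absurd h hKM
    · exact h
  obtain ⟨T, rfl⟩ : ∃ T, K = T + 1 := ⟨K - 1, by omega⟩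
  have hMT : M ≤ T := by omega
  have hMT' : (M : ℝ) ≤ T := by exact_mod_cast hMT
  have hTR : (T : ℝ) ≤ R := by push_cast at hK'; linarith
  rw [Finset.sum_eq_sum_Ico_succ_bot (by omega), ← Finset.sum_Ico_add']
  have hanti : AntitoneOn (fun t : ℝ => t ^ (-s)) (Set.Icc (M:ℝ) T) := by
    intro a ha b hb hab
    exact Real.rpow_le_rpow_of_nonpos (by linarith [ha.1]) hab (by linarith)
  have h1 := AntitoneOn.sum_le_integral_Ico hMT hanti
  gcongr
  refine h1.trans ?_
  unfold Ibd
  split_ifs with h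
  · rw [integral_rpow (Or.inl (by linarith)), show -s + 1 = 1 - s by ring]
    have : 0 < 1 - s := by linarith
    gcongr
    have a1 : (T : ℝ) ^ (1 - s) ≤ R ^ (1 - s) := by gcongr
    have a2 : 0 ≤ (M : ℝ) ^ (1 - s) := by positivity
    linarith
  · have hs' : s = 1 := le_antisymm hs1 (not_lt.1 h)
    subst hs'
    simp only [Real.rpow_neg_one]
    rw [integral_inv_of_pos (by linarith) (by linarith)]
    apply Real.log_le_log (by apply div_pos <;> linarith)
    rw [div_le_div_iff₀ (by linarith) hq]
    nlinarith

theorem W0_bound (s : ℝ) (hs : 1/2 < s) (hs1 : s ≤ 1) (q q' h : ℝ) (hq : 1 ≤ q) (hqq : q ≤ q')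
    (hh1 : 1 / (2 * (q * q')) ≤ |h|) (hh2 : |h| ≤ 1 / (q * q'))
    (M N : ℕ) (hM : 1 ≤ M) (hqM : q ≤ 12 * M) (hMN : M ≤ N) (hN : 6 * (N : ℝ) ≤ q') :
    ‖∑ n ∈ Finset.Ico M N, (((n : ℝ) ^ (-s) : ℝ) : ℂ) * ee (h * n ^ 2)‖ ≤
      (M : ℝ) ^ (-s) + Ibd s q (√(q * q')) + 2 * (√(q * q')) ^ (1 - s) := by
  have hq0 : 0 < q := by linarith
  have hq0' : 0 < q' := by linarith
  set R := √(q * q') with hR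
  have hR2 : R ^ 2 = q * q' := Real.sq_sqrt (by positivity)
  have hqR : q ≤ R := Real.le_sqrt_of_sq_le (by nlinarith)
  have hR0 : 0 < R := by linarith
  have hpos : 0 < |h| := lt_of_lt_of_le (by positivity) hh1
  have hN1 : (1 : ℝ) ≤ N := by exact_mod_cast hM.trans hMN
  have triv : ∀ A B : ℕ, ‖∑ n ∈ Finset.Ico A B, (((n : ℝ) ^ (-s) : ℝ) : ℂ) * ee (h * n ^ 2)‖
      ≤ ∑ n ∈ Finset.Ico A B, (n : ℝ) ^ (-s) := by
    intro A B
    refine (norm_sum_le _ _).trans (Finset.sum_le_sum fun n _ => ?_)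
    rw [norm_mul, ee_norm, mul_one, Complex.norm_real, Real.norm_of_nonneg (by positivity)]
  have hK1 : R ≤ ⌈R⌉₊ := Nat.le_ceil R
  have hK2 : (⌈R⌉₊ : ℝ) < R + 1 := Nat.ceil_lt_add_one hR0.le
  set K := ⌈R⌉₊
  by_cases hNK : N ≤ K
  · refine (triv M N).trans ((sumA s hs hs1 q R hq0 hqR M N hM hqM (Or.inr ?_)).trans ?_)
    · have : (N : ℝ) ≤ K := by exact_mod_cast hNK
      linarith
    · have : 0 ≤ 2 * R ^ (1 - s) := by positivity
      linarith
  set L := max M K with hL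
  have hML : M ≤ L := le_max_left _ _
  have hLN : L ≤ N := max_le hMN (by omega)
  have hRL : R ≤ L := hK1.trans (by exact_mod_cast le_max_right M K)
  have hL0 : (0:ℝ) < L := by linarith
  rw [← Finset.sum_Ico_consecutive _ hML hLN]
  refine (norm_add_le _ _).trans (add_le_add ?_ ?_)
  · refine (triv M L).trans (sumA s hs hs1 q R hq0 hqR M L hM hqM ?_)
    rcases le_total K M with e | e
    · left; exact max_le le_rfl e
    · right; rw [hL, max_eq_right e]; exact hK2.le
  · have hab := abel_bound (fun n => ee (h * n ^ 2)) (fun n => (n : ℝ) ^ (-s)) L (1 / (|h| * L))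
      (fun n _ => by positivity) (fun n hn => w_anti s (by linarith) L (by omega) n hn) N hLN (by
        intro T hLT hTN
        apply W_zero h hpos L T (by omega) hLT
        have hTN' : (T : ℝ) ≤ N := by exact_mod_cast hTN
        calc |h| * (2 * T + 1) ≤ (1 / (q * q')) * (q' / 2) := by
              apply mul_le_mul hh2 (by linarith) (by positivity) (by positivity)
          _ = 1 / (2 * q) := by field_simp
          _ ≤ 1 / 2 := by gcongr; linarith)
    refine hab.trans ?_
    have h1 : (L : ℝ) ^ (-s) ≤ R ^ (-s) := Real.rpow_le_rpow_of_nonpos hR0 hRL (by linarith)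
    have h2 : 1 / (|h| * L) ≤ 2 * R := by
      rw [div_le_iff₀ (by positivity)]
      have : 1 / (2 * R^2) * R ≤ |h| * L := by
        apply mul_le_mul _ hRL hR0.le hpos.le
        rw [hR2]; exact hh1
      calc (1:ℝ) = 2 * R * (1 / (2 * R^2) * R) := by field_simp
        _ ≤ _ := by gcongr
    calc _ ≤ R ^ (-s) * (2 * R) := by
          apply mul_le_mul h1 h2 (by positivity) (by positivity)
      _ = 2 * R ^ (1 - s) := by
          rw [show 1 - s = -s + 1 by ring, Real.rpow_add_one hR0.ne']; ring

theorem main_term (s : ℝ) (hs : 1/2 < s) (hs1 : s ≤ 1) (q q' : ℝ) (hq : 1 ≤ q) (hqq : q ≤ q') :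
    √(2 * q) / q * (12 * q ^ (-s) + Ibd s q (√(q * q')) + 2 * (√(q * q')) ^ (1 - s)) ≤
      (100 + 2 / (1 - s)) * (q ^ (-((s - 1/2) / 2)) +
        (if s < 1 then 1 else Real.log (q' / q)) * √(q' / (q * q') ^ s)) := by
  have hq0 : 0 < q := by linarith
  have hq0' : 0 < q' := by linarith
  have hP : 0 < q * q' := by positivity
  set ε : ℝ := (s - 1/2) / 2 with hε
  set R := √(q * q') with hR
  have hR2 : R ^ 2 = q * q' := Real.sq_sqrt (by positivity)
  have hR0 : 0 < R := Real.sqrt_pos.2 hP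
  set T := q' / (q * q') ^ s with hT
  have hT0 : 0 ≤ √T := Real.sqrt_nonneg _
  set A := √(2 * q) / q with hA
  have hA0 : 0 ≤ A := by positivity
  have s2 : √(2:ℝ) ≤ 2 := by rw [Real.sqrt_le_left (by norm_num)]; norm_num
  have s20 : 0 ≤ √(2:ℝ) := Real.sqrt_nonneg _
  have hAR : A * R ^ (1 - s) = √2 * √T := by
    have h1 : (A * R ^ (1 - s)) ^ 2 = 2 * T := by
      have e1 : (R ^ (1 - s)) ^ 2 = (q * q') / (q * q') ^ s := by
        rw [← Real.rpow_natCast, ← Real.rpow_mul hR0.le, mul_comm, Real.rpow_mul hR0.le,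
          Real.rpow_natCast, hR2, Real.rpow_sub hP, Real.rpow_one]
      rw [mul_pow, e1, hA, div_pow, Real.sq_sqrt (by positivity), hT]
      field_simp
    rw [← Real.sqrt_mul (by norm_num), ← h1, Real.sqrt_sq (by positivity)]
  have hqe0 : 0 ≤ q ^ (-ε) := by positivity
  have hAq : A ≤ 2 * q ^ (-ε) := by
    have e1 : A = √2 * q ^ (-(1/2) : ℝ) := by
      rw [hA, Real.sqrt_mul (by norm_num), Real.rpow_neg hq0.le, ← Real.sqrt_eq_rpow]
      have : √q * √q = q := Real.mul_self_sqrt hq0.le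
      have : 0 < √q := Real.sqrt_pos.2 hq0
      field_simp
      nlinarith
    rw [e1]
    have : q ^ (-(1/2) : ℝ) ≤ q ^ (-ε) := Real.rpow_le_rpow_of_exponent_le hq (by rw [hε]; linarith)
    apply mul_le_mul s2 this (by positivity) (by norm_num)
  have hqs : q ^ (-s) ≤ 1 := Real.rpow_le_one_of_one_le_of_nonpos hq (by linarith)
  have hqs0 : 0 ≤ q ^ (-s) := by positivity
  have t1 : A * (12 * q ^ (-s)) ≤ 24 * q ^ (-ε) := by
    calc _ ≤ A * (12 * 1) := by gcongr
      _ ≤ _ := by linarith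
  by_cases h : s < 1
  · simp only [Ibd, h, if_true, one_mul]
    have h1s : 0 < 1 - s := by linarith
    have hi : 0 ≤ 2 / (1 - s) := by positivity
    have t2 : A * (R ^ (1 - s) / (1 - s) + 2 * R ^ (1 - s)) ≤ (2 / (1 - s) + 4) * √T := by
      calc _ = (1 / (1 - s) + 2) * (A * R ^ (1 - s)) := by ring
        _ = (1 / (1 - s) + 2) * (√2 * √T) := by rw [hAR]
        _ ≤ (1 / (1 - s) + 2) * (2 * √T) := by gcongr
        _ = _ := by ring
    have : (2 / (1 - s) + 4) * √T ≤ (100 + 2 / (1 - s)) * √T := by gcongr ?_ * _; linarith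
    have : 24 * q ^ (-ε) ≤ (100 + 2 / (1 - s)) * q ^ (-ε) := by gcongr ?_ * _; linarith
    calc _ = A * (12 * q ^ (-s)) + A * (R ^ (1 - s) / (1 - s) + 2 * R ^ (1 - s)) := by ring
      _ ≤ _ := by linarith
  · have hs' : s = 1 := le_antisymm hs1 (not_lt.1 h)
    simp only [Ibd, h, if_false]
    have hx1 : R ^ (1 - s) = 1 := by rw [hs']; simp
    have hl0 : 0 ≤ Real.log (q' / q) := Real.log_nonneg (by rw [le_div_iff₀ hq0]; linarith)
    have hlog : Real.log (12 * R / q) ≤ 11 + 1/2 * Real.log (q' / q) := by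
      rw [Real.log_div (by positivity) hq0.ne', Real.log_mul (by norm_num) hR0.ne', hR,
        Real.log_sqrt hP.le, Real.log_mul hq0.ne' hq0'.ne', Real.log_div hq0'.ne' hq0.ne']
      have := Real.log_le_sub_one_of_pos (x := 12) (by norm_num)
      linarith
    rw [hx1, mul_one] at hAR ⊢
    have h00 : 2 / (1 - s) = 0 := by rw [hs']; simp
    rw [h00]
    have t3 : A * (1/2 * Real.log (q' / q)) ≤ Real.log (q' / q) * √T := by
      rw [hAR]
      have : √2 * √T ≤ 2 * √T := by gcongr
      nlinarith
    have t4 : 0 ≤ Real.log (q' / q) * √T := by positivity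
    calc _ ≤ A * (12 * q ^ (-s) + (11 + 1/2 * Real.log (q' / q)) + 2) := by gcongr
      _ = A * (12 * q ^ (-s)) + 13 * A + A * (1/2 * Real.log (q' / q)) := by ring
      _ ≤ _ := by linarith

theorem err_term (s : ℝ) (hs : 1/2 < s) (q : ℝ) (hq : 1 ≤ q) :
    12 * q ^ (-s) * (4 * √(2 * q) * (1 + Real.log q)) ≤
      96 * (1 + 1 / ((s - 1/2) / 2)) * q ^ (-((s - 1/2) / 2)) := by
  have hq0 : 0 < q := by linarith
  set ε : ℝ := (s - 1/2) / 2 with hε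
  have hε0 : 0 < ε := by rw [hε]; linarith
  have h1 : Real.log q ≤ q ^ ε / ε := Real.log_le_rpow_div hq0.le hε0
  have h2 : 1 ≤ q ^ ε := Real.one_le_rpow hq hε0.le
  have h3 : 1 + Real.log q ≤ (1 + 1 / ε) * q ^ ε := by
    calc _ ≤ q ^ ε + q ^ ε / ε := by linarith
      _ = _ := by ring
  have h4 : √(2 * q) ≤ 2 * q ^ (1/2 : ℝ) := by
    rw [Real.sqrt_mul (by norm_num), ← Real.sqrt_eq_rpow]
    gcongr
    rw [Real.sqrt_le_left (by norm_num)]; norm_num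
  have hl : 0 ≤ 1 + Real.log q := by linarith [Real.log_nonneg hq]
  calc _ ≤ 12 * q ^ (-s) * (4 * (2 * q ^ (1/2 : ℝ)) * ((1 + 1 / ε) * q ^ ε)) := by gcongr
    _ = 96 * (1 + 1 / ε) * (q ^ (-s) * q ^ (1/2 : ℝ) * q ^ ε) := by ring
    _ = _ := by
      rw [← Real.rpow_add hq0, ← Real.rpow_add hq0]
      congr 2
      rw [hε]; ring

theorem sum_q_eps (x : ℝ) (hirr : Irrational x) (hx : x ∈ Set.Ioo (0:ℝ) 1) (ε : ℝ) (hε : 0 < ε) :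
    Summable (fun j => (cfQ x j : ℝ) ^ (-ε)) := by
  have hr : (2:ℝ) ^ (-(ε/2)) < 1 := Real.rpow_lt_one_of_one_lt_of_neg (by norm_num) (by linarith)
  have hg := (summable_geometric_of_lt_one (by positivity) hr).mul_left ((2:ℝ) ^ (ε/2))
  refine Summable.of_nonneg_of_le (fun j => ?_) (fun j => ?_) hg
  · have h0 : (1:ℝ) ≤ cfQ x j := by exact_mod_cast (cfQ_pos x hirr hx j).1
    positivity
  · have h0 : (1:ℝ) ≤ cfQ x j := by exact_mod_cast (cfQ_pos x hirr hx j).1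
    have h0' : (0:ℝ) < cfQ x j := by linarith
    have h1 := (cfQ_growth x hirr hx j).1
    have h2 : (2:ℝ) ^ j / 2 ≤ (cfQ x j : ℝ) ^ 2 := by linarith
    have h3 := Real.rpow_le_rpow_of_nonpos (by positivity) h2 (by linarith : -(ε/2) ≤ 0)
    have e1 : ((cfQ x j : ℝ) ^ 2) ^ (-(ε/2)) = (cfQ x j : ℝ) ^ (-ε) := by
      rw [← Real.rpow_natCast, ← Real.rpow_mul h0'.le]; congr 1; push_cast; ring
    have e2 : ((2:ℝ) ^ j / 2) ^ (-(ε/2)) = (2:ℝ) ^ (ε/2) * ((2:ℝ) ^ (-(ε/2))) ^ j := by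
      rw [Real.div_rpow (by positivity) (by norm_num), ← Real.rpow_natCast, ← Real.rpow_natCast,
        ← Real.rpow_mul (by norm_num), ← Real.rpow_mul (by norm_num), Real.rpow_neg (by norm_num) (ε/2),
        div_inv_eq_mul, mul_comm (j:ℝ), mul_comm]
    rw [e1, e2] at h3
    exact h3

theorem cfQ_lin (x : ℝ) (hirr : Irrational x) (hx : x ∈ Set.Ioo (0:ℝ) 1) (j : ℕ) :
    (j : ℤ) ≤ 2 * cfQ x j ∧ ((j + 1 : ℕ) : ℤ) ≤ 2 * cfQ x (j+1) := by
  induction j with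
  | zero =>
    have h0 := cfQ_pos x hirr hx 0
    have h1 := cfQ_pos x hirr hx 1
    constructor
    · push_cast; omega
    · push_cast; omega
  | succ j ih =>
    refine ⟨ih.2, ?_⟩
    have h0 := cfQ_pos x hirr hx j
    have h1 := cfQ_two x hirr hx j
    have h2 := ih.1
    show _ ≤ 2 * cfQ x (j+2)
    push_cast
    omega

theorem block_final (s : ℝ) (hs : 1/2 < s) (hs1 : s ≤ 1) (x : ℝ) (hx : x ∈ Set.Ioo (0:ℝ) 1)
    (hirr : Irrational x) (j : ℕ) (hj : 1 ≤ j) (M N : ℕ) (hM : 1 ≤ M) (hMN : M ≤ N)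
    (hqM : (cfQ x j : ℝ) ≤ 12 * M) (hN : 6 * (N : ℝ) ≤ cfQ x (j+1)) :
    ‖∑ n ∈ Finset.Ico M N, (((n : ℝ) ^ (-s) : ℝ) : ℂ) * ee (x * n ^ 2)‖ ≤
      (96 * (1 + 1 / ((s - 1/2) / 2)) + (100 + 2 / (1 - s))) * (cfQ x j : ℝ) ^ (-((s - 1/2) / 2))
      + (100 + 2 / (1 - s)) * (if 1 ≤ j ∧ cfQ x j % 4 ≠ 2 then sigTerm s x j else 0) := by
  obtain ⟨hQ1, hQ2⟩ := cfQ_pos x hirr hx j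
  obtain ⟨hh1, hh2⟩ := cfH_bounds x hirr hx j
  have hcop := cf_coprime x j
  have hq1 : (1:ℝ) ≤ cfQ x j := by exact_mod_cast hQ1
  have hqq : (cfQ x j : ℝ) ≤ cfQ x (j+1) := by exact_mod_cast hQ2
  have hM' : (1:ℝ) ≤ M := by exact_mod_cast hM
  have hxh : x = (cfP x j : ℝ) / (cfQ x j : ℝ) + cfH x j := by unfold cfH; ring
  have hsig : (if s < 1 then 1 else Real.log ((cfQ x (j+1) : ℝ) / cfQ x j)) *
      √((cfQ x (j+1) : ℝ) / ((cfQ x j : ℝ) * cfQ x (j+1)) ^ s) = sigTerm s x j := rfl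
  have hmain := main_term s hs hs1 _ _ hq1 hqq
  rw [hsig] at hmain
  have herr := err_term s hs _ hq1
  have hW0 := W0_bound s hs hs1 _ _ _ hq1 hqq hh1 hh2 M N hM hqM hMN hN
  have hMs : (M : ℝ) ^ (-s) ≤ 12 * (cfQ x j : ℝ) ^ (-s) := by
    have h1 : (M : ℝ) ^ (-s) ≤ ((cfQ x j : ℝ) / 12) ^ (-s) :=
      Real.rpow_le_rpow_of_nonpos (by linarith) (by linarith) (by linarith)
    rw [Real.div_rpow (by linarith) (by norm_num), Real.rpow_neg (by norm_num : (0:ℝ) ≤ 12),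
      div_inv_eq_mul] at h1
    have h2 : (12:ℝ) ^ s ≤ 12 := by
      calc (12:ℝ) ^ s ≤ 12 ^ (1:ℝ) := Real.rpow_le_rpow_of_exponent_le (by norm_num) hs1
        _ = 12 := Real.rpow_one _
    have h3 : 0 ≤ (cfQ x j : ℝ) ^ (-s) := by positivity
    nlinarith
  obtain ⟨q, hq⟩ : ∃ q : ℕ, cfQ x j = (q : ℤ) := ⟨(cfQ x j).toNat, by omega⟩
  have hqr : (cfQ x j : ℝ) = (q : ℝ) := by rw [hq]; simp
  rw [hq] at hcop
  rw [hqr] at hqM hh1 hh2 hq1 hqq hxh hmain herr hW0 hMs ⊢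
  have : NeZero q := ⟨by omega⟩
  have hlog : 0 ≤ 1 + Real.log q := by linarith [Real.log_nonneg hq1]
  have hb := block_est s (by linarith) q (cfP x j) hcop (cfQ x (j+1)) (cfH x j) x (by linarith) hxh hh2
    M N hM hMN hN
  have hfirst : (M : ℝ) ^ (-s) * (4 * √(2 * q) * (1 + Real.log q)) ≤
      96 * (1 + 1 / ((s - 1/2) / 2)) * (q : ℝ) ^ (-((s - 1/2) / 2)) := by
    refine le_trans ?_ herr
    gcongr
  have hC : 0 ≤ 2 / (1 - s) := div_nonneg (by norm_num) (by linarith)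
  have hqe : 0 ≤ (q : ℝ) ^ (-((s - 1/2) / 2)) := by positivity
  refine hb.trans ?_
  rw [hq]
  by_cases h4 : q % 4 = 2
  · rw [Gs_zero q _ hcop h4, norm_zero, zero_div, zero_mul, if_neg (by omega)]
    have : 0 ≤ (100 + 2 / (1 - s)) * (q : ℝ) ^ (-((s - 1/2) / 2)) := by positivity
    linarith
  · rw [if_pos (by omega)]
    have hunit : IsUnit ((cfP x j : ℤ) : ZMod q) := by
      obtain ⟨a, b, hab⟩ := hcop
      refine IsUnit.of_mul_eq_one (a : ZMod q) ?_
      have := congrArg (fun t : ℤ => (t : ZMod q)) hab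
      push_cast at this
      simp only [ZMod.natCast_self, mul_zero, add_zero] at this
      rw [mul_comm]; exact this
    have hG := Gs_norm q _ 0 hunit
    have hsecond : ‖Gs q ((cfP x j : ℤ) : ZMod q) 0‖ / q *
        ‖∑ n ∈ Finset.Ico M N, (((n : ℝ) ^ (-s) : ℝ) : ℂ) * ee (cfH x j * n ^ 2)‖ ≤
        √(2 * q) / q * (12 * (q : ℝ) ^ (-s) + Ibd s q (√(q * cfQ x (j+1)))
          + 2 * (√(q * cfQ x (j+1))) ^ (1 - s)) := by
      gcongr
      linarith
    linarith

/-- For `s ∈ (1/2,1]` and an irrational `x ∈ (0,1)`, if `Σ_s(x) < ∞`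
then `F_{s,N}(x)` converges as `N → ∞`. -/
theorem converges_of_SigmaS_finite (s : ℝ) (hs : s ∈ Set.Ioc (1/2 : ℝ) 1)
    (x : ℝ) (hx : x ∈ Set.Ioo (0 : ℝ) 1) (hirr : Irrational x)
    (hSig : SigmaS s x < ⊤) :
    ∃ L : ℂ, Filter.Tendsto (fun N : ℕ => FsN s N x) Filter.atTop (nhds L) := by
  obtain ⟨hs0, hs1⟩ := hs
  set ε : ℝ := (s - 1/2) / 2 with hε
  have hε0 : 0 < ε := by rw [hε]; linarith
  set a : ℕ → ℂ := fun n => (((n : ℝ) ^ (-s) : ℝ) : ℂ) * ee (x * n ^ 2) with ha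
  have hF : ∀ N : ℕ, FsN s N x = ∑ n ∈ Finset.range (N + 1), a n := by
    intro N
    rw [Finset.range_eq_Ico, Finset.sum_eq_sum_Ico_succ_bot (by omega)]
    have h0 : a 0 = 0 := by
      simp only [ha, Nat.cast_zero]
      rw [Real.zero_rpow (by linarith)]; simp
    rw [h0, zero_add]
    unfold FsN
    refine Finset.sum_congr (by ext n; simp only [Finset.mem_Icc, Finset.mem_Ico]; omega) fun n _ => ?_
    simp only [ha, ee]
    congr 2
    push_cast; ring
  set f : ℕ → ℝ := fun j => if 1 ≤ j ∧ cfQ x j % 4 ≠ 2 then sigTerm s x j else 0 with hf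
  have hpos : ∀ j, 0 ≤ sigTerm s x j := by
    intro j
    have h0 : (1:ℝ) ≤ cfQ x j := by exact_mod_cast (cfQ_pos x hirr hx j).1
    have h1 : (cfQ x j : ℝ) ≤ cfQ x (j+1) := by exact_mod_cast (cfQ_pos x hirr hx j).2
    unfold sigTerm deltaJ
    apply mul_nonneg _ (Real.sqrt_nonneg _)
    split_ifs
    · norm_num
    · exact Real.log_nonneg (by rw [le_div_iff₀ (by linarith)]; linarith)
  have hfs : Summable f := by
    have h := ENNReal.summable_toReal hSig.ne
    refine h.congr fun j => ?_
    simp only [hf]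
    split_ifs
    · exact ENNReal.toReal_ofReal (hpos j)
    · simp
  set Q : ℕ → ℕ := fun j => (cfQ x j).toNat with hQ
  have hQc : ∀ j, (Q j : ℤ) = cfQ x j := fun j => by
    have := (cfQ_pos x hirr hx j).1
    simp only [hQ]; omega
  have hQm : Monotone Q := monotone_nat_of_le_succ fun j => by
    have := (cfQ_pos x hirr hx j).2
    simp only [hQ]; omega
  have hQl : ∀ j, j ≤ 2 * Q j := fun j => by
    have := (cfQ_lin x hirr hx j).1
    have := hQc j
    omega
  obtain ⟨L, hL⟩ := conv_of_blocks a (fun j => Q j / 6)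
    (fun j => (96 * (1 + 1 / ε) + (100 + 2 / (1 - s))) * (cfQ x j : ℝ) ^ (-ε)
      + (100 + 2 / (1 - s)) * f j)
    (fun i j hij => Nat.div_le_div_right (hQm hij))
    (tendsto_atTop.2 fun b => by
      filter_upwards [eventually_ge_atTop (12 * b)] with j hj
      have := hQl j
      omega)
    (((sum_q_eps x hirr hx ε hε0).mul_left _).add (hfs.mul_left _)) 12 (by
      intro j hj K h1 h2
      have hq6 := hQl j
      have hqr : (cfQ x j : ℝ) = (Q j : ℝ) := by rw [← hQc]; simp
      have hqr' : (cfQ x (j+1) : ℝ) = (Q (j+1) : ℝ) := by rw [← hQc]; simp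
      refine block_final s hs0 hs1 x hx hirr j (by omega) (Q j / 6) K (by omega) h1 ?_ ?_
      · rw [hqr]; exact_mod_cast (by omega : Q j ≤ 12 * (Q j / 6))
      · rw [hqr']; exact_mod_cast (by omega : 6 * K ≤ Q (j+1)))
  refine ⟨L, ?_⟩
  simp only [hF]
  exact (tendsto_add_atTop_iff_nat 1).2 hL
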